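/- Let a, b : ℝ → ℝ both be Lipschitz with constants k_a < 1 and k_b < 1 respectively, and for each t ∈ ℝ let T(t) denote the unique real number satisfying T(t) = t + |b(T(t)) − a(t)|. Then T is strictly increasing: t₁ < t₂ implies T(t₁) < T(t₂). -/

import Mathlib

/-- If `a, b : ℝ → ℝ` are Lipschitz with constants `< 1` and `T t` denotes the
unique reception time satisfying `T t = t + |b (T t) - a t|`, then `T` is
strictly increasing: what is transmitted later arrives later. -/
theorem reception_time_strictMono (a b : ℝ → ℝ) (ka kb : NNReal)
    (hka : (ka : ℝ) < 1) (hkb : (kb : ℝ) < 1)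
    (ha : LipschitzWith ka a) (hb : LipschitzWith kb b)
    (T : ℝ → ℝ) (hT : ∀ t : ℝ, T t = t + |b (T t) - a t|) :
    StrictMono T := by
  intro s t hst
  by_contra! h
  have hA : |a s - a t| ≤ ka * (t - s) := by
    simpa [Real.dist_eq, abs_sub_comm s t, abs_of_pos (sub_pos.2 hst)] using ha.dist_le_mul s t
  have hB : |b (T s) - b (T t)| ≤ kb * (T s - T t) := by
    simpa [Real.dist_eq, abs_of_nonneg (sub_nonneg.2 h)] using hb.dist_le_mul (T s) (T t)
  have habs : |b (T s) - a s| - |b (T t) - a t| ≤ |b (T s) - b (T t)| + |a s - a t| :=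
    calc |b (T s) - a s| - |b (T t) - a t|
        ≤ |(b (T s) - a s) - (b (T t) - a t)| := abs_sub_abs_le_abs_sub _ _
      _ = |(b (T s) - b (T t)) - (a s - a t)| := by rw [sub_sub_sub_comm]
      _ ≤ |b (T s) - b (T t)| + |a s - a t| := abs_sub _ _
  have hkA : 0 < (1 - (ka : ℝ)) * (t - s) := mul_pos (sub_pos.2 hka) (sub_pos.2 hst)
  have hkB : 0 ≤ (1 - (kb : ℝ)) * (T s - T t) :=
    mul_nonneg (sub_pos.2 hkb).le (sub_nonneg.2 h)
  linarith [hT s, hT t]
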